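/- Let N ≥ 4 and 1 < γ < 2(N−1)/N. There is no global classical solution with positive total mass on [0,∞) of the N-dimensional Euler–Poisson equations without damping (β = 0) whose conserved total energy satisfies E = 0; i.e., every such classical solution with E = 0 blows up in finite time. -/

import Mathlib

open MeasureTheory Real Filter
open scoped RealInnerProductSpace Topology

noncomputable section

/-- Euclidean space `ℝ^N`. -/
abbrev Euc (N : ℕ) := EuclideanSpace ℝ (Fin N)

/-- Divergence of a vector field on `ℝ^N`. -/
def ediv {N : ℕ} (v : Euc N → Euc N) (x : Euc N) : ℝ :=
  ∑ i, fderiv ℝ (fun y => v y i) x (EuclideanSpace.single i 1)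

/-- Partial derivative of a scalar field in the `i`-th coordinate direction. -/
def epartial {N : ℕ} (i : Fin N) (f : Euc N → ℝ) (x : Euc N) : ℝ :=
  fderiv ℝ f x (EuclideanSpace.single i 1)

/-- Green's function of the Poisson equation in `ℝ^N`:
`log |x|` for `N = 2` and `-|x|^(2-N)` for `N ≥ 3`. -/
def green (N : ℕ) (x : Euc N) : ℝ :=
  if N = 2 then Real.log ‖x‖ else -(‖x‖ ^ ((2 : ℝ) - (N : ℝ)))

/-- Gravitational potential `Φ(t,x) = g ∫ G(x-y) ρ(t,y) dy`. -/
def potential (N : ℕ) (g : ℝ) (ρ : ℝ → Euc N → ℝ) (t : ℝ) (x : Euc N) : ℝ :=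
  g * ∫ y, green N (x - y) * ρ t y

/-- A classical solution on `[0,T)` (with `T : EReal`, so `T = ⊤` means a global
solution) of the `N`-dimensional Euler–Poisson equations with pressure
`P = K ρ^γ`, damping constant `β` and gravitational constant `g`:
nonnegative `C¹` density `ρ`, `C¹` velocity `u`, with `ρ(t,·)` supported in a
fixed bounded open set `Ω`, satisfying the continuity and momentum equations
pointwise. -/
structure IsEPSolution (N : ℕ) (K γ β g : ℝ) (Ω : Set (Euc N)) (T : EReal)
    (ρ : ℝ → Euc N → ℝ) (u : ℝ → Euc N → Euc N) : Prop where
  rho_nonneg : ∀ t x, 0 ≤ ρ t x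
  rho_C1 : ContDiff ℝ 1 (fun p : ℝ × Euc N => ρ p.1 p.2)
  u_C1 : ContDiff ℝ 1 (fun p : ℝ × Euc N => u p.1 p.2)
  omega_open : IsOpen Ω
  omega_bounded : Bornology.IsBounded Ω
  support_subset : ∀ t : ℝ, 0 ≤ t → (t : EReal) < T → Function.support (ρ t) ⊆ Ω
  continuity_eq : ∀ t : ℝ, 0 ≤ t → (t : EReal) < T → ∀ x : Euc N,
    deriv (fun s => ρ s x) t + ediv (fun y => ρ t y • u t y) x = 0
  momentum_eq : ∀ t : ℝ, 0 ≤ t → (t : EReal) < T → ∀ x : Euc N, ∀ j : Fin N,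
    deriv (fun s => ρ s x * u s x j) t
      + (∑ i, epartial i (fun y => ρ t y * u t y i * u t y j) x)
      + epartial j (fun y => K * ρ t y ^ γ) x
      = -(ρ t x * epartial j (potential N g ρ t) x) - β * ρ t x * u t x j

/-- Total energy (case `γ > 1`):
`E(t) = ∫_Ω (½ ρ|u|² + P/(γ-1) + ½ ρΦ) dx` with `P = K ρ^γ`. -/
def energy (N : ℕ) (K γ g : ℝ) (Ω : Set (Euc N)) (ρ : ℝ → Euc N → ℝ)
    (u : ℝ → Euc N → Euc N) (t : ℝ) : ℝ :=
  ∫ x in Ω, ((1 / 2) * ρ t x * ‖u t x‖ ^ 2 + K * ρ t x ^ γ / (γ - 1)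
    + (1 / 2) * ρ t x * potential N g ρ t x)

/-- Isothermal total energy (case `γ = 1`, `P = Kρ`):
`E(t) = ∫_Ω (½ ρ|u|² + Kρ log ρ + ½ ρΦ) dx` (note `ρ log ρ = 0` where `ρ = 0`
since `Real.log 0 = 0`). -/
def energyIso (N : ℕ) (K g : ℝ) (Ω : Set (Euc N)) (ρ : ℝ → Euc N → ℝ)
    (u : ℝ → Euc N → Euc N) (t : ℝ) : ℝ :=
  ∫ x in Ω, ((1 / 2) * ρ t x * ‖u t x‖ ^ 2 + K * ρ t x * Real.log (ρ t x)
    + (1 / 2) * ρ t x * potential N g ρ t x)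

/-- Second inertia function `H(t) = ∫_Ω ρ(t,x)|x|² dx`. -/
def inertia (N : ℕ) (Ω : Set (Euc N)) (ρ : ℝ → Euc N → ℝ) (t : ℝ) : ℝ :=
  ∫ x in Ω, ρ t x * ‖x‖ ^ 2

/-- Maximal radius of the support of `ρ(t,·)`. -/
def maxRadius (N : ℕ) (ρ : ℝ → Euc N → ℝ) (t : ℝ) : ℝ :=
  sSup ((fun x : Euc N => ‖x‖) '' Function.support (ρ t))

lemma locInt_green {N : ℕ} (hN : 4 ≤ N) :
    LocallyIntegrable (fun z : Euc N => ‖z‖ ^ ((2 : ℝ) - (N : ℝ))) volume := by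
  rw [locallyIntegrable_iff]
  intro k hk
  obtain ⟨R, hR⟩ := hk.isBounded.subset_ball (0 : Euc N)
  refine IntegrableOn.mono_set ?_ hR
  have : Nonempty (Fin N) := ⟨⟨0, by omega⟩⟩
  have : Nontrivial (Euc N) := inferInstance
  rw [integrableOn_fun_norm_addHaar volume (f := fun s : ℝ => s ^ ((2 : ℝ) - (N : ℝ)))]
  have h1 : IntegrableOn (fun y : ℝ => y) (Set.Ioo 0 R) :=
    (continuous_id.integrableOn_Icc).mono_set Set.Ioo_subset_Icc_self
  refine h1.congr_fun ?_ measurableSet_Ioo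
  intro y hy
  simp only [finrank_euclideanSpace, Fintype.card_fin, smul_eq_mul]
  rw [← Real.rpow_natCast, ← Real.rpow_add hy.1, Nat.cast_sub (by omega)]
  ring_nf
  simp

lemma conv_props {N : ℕ} {k : Euc N → ℝ} (hk : LocallyIntegrable k volume)
    {r : Euc N → ℝ} (hr : ContDiff ℝ 1 r) (hc : HasCompactSupport r) :
    ContDiff ℝ 1 (fun x => ∫ y, k (x - y) * r y) ∧
    ∀ j x, epartial j (fun x => ∫ y, k (x - y) * r y) x = ∫ y, k (x - y) * epartial j r y := by
  have e : ∀ (h : Euc N → ℝ), (fun x => ∫ y, k (x - y) * h y) =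
      MeasureTheory.convolution k h (ContinuousLinearMap.mul ℝ ℝ) volume := by
    intro h
    ext x
    rw [convolution_def]
    rw [← integral_sub_left_eq_self _ volume x]
    simp
  refine ⟨?_, ?_⟩
  · rw [e]
    exact_mod_cast hc.contDiff_convolution_right (n := 1) _ hk (by exact_mod_cast hr)
  · intro j x
    have h2 := congrFun (e (epartial j r)) x
    rw [e, h2, epartial, (hc.hasFDerivAt_convolution_right _ hk hr x).fderiv,
      convolution_precompR_apply _ hk (hc.fderiv ℝ) (hr.continuous_fderiv one_ne_zero)]
    rfl

lemma epartial_cont {N : ℕ} {f : Euc N → ℝ} (hf : ContDiff ℝ 1 f) (i : Fin N) :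
    Continuous (epartial i f) :=
  (hf.continuous_fderiv one_ne_zero).clm_apply continuous_const

lemma epartial_cs {N : ℕ} {f : Euc N → ℝ} (hf : HasCompactSupport f) (i : Fin N) :
    HasCompactSupport (epartial i f) := by
  exact (hf.fderiv ℝ).comp_left (g := fun L : Euc N →L[ℝ] ℝ => L (EuclideanSpace.single i 1)) (by simp)

lemma ibp {N : ℕ} {f h : Euc N → ℝ} (hf : ContDiff ℝ 1 f) (hh : ContDiff ℝ 1 h)
    (hc : HasCompactSupport f) (i : Fin N) :
    ∫ x, h x * epartial i f x = - ∫ x, epartial i h x * f x := by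
  refine integral_mul_fderiv_eq_neg_fderiv_mul_of_integrable ?_ ?_ ?_ ?_ ?_
  · exact Continuous.integrable_of_hasCompactSupport
      ((epartial_cont hh i).mul hf.continuous) hc.mul_left
  · exact Continuous.integrable_of_hasCompactSupport
      (hh.continuous.mul (epartial_cont hf i)) (epartial_cs hc i).mul_left
  · exact Continuous.integrable_of_hasCompactSupport
      (hh.continuous.mul hf.continuous) hc.mul_left
  · exact fun x _ => (hh.differentiable one_ne_zero) x
  · exact fun x _ => (hf.differentiable one_ne_zero) x

lemma epartial_coord {N : ℕ} (i j : Fin N) (x : Euc N) :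
    epartial i (fun y : Euc N => y j) x = if j = i then 1 else 0 := by
  have : HasFDerivAt (fun y : Euc N => y j) (EuclideanSpace.proj j : Euc N →L[ℝ] ℝ) x :=
    (EuclideanSpace.proj j : Euc N →L[ℝ] ℝ).hasFDerivAt
  rw [epartial, this.fderiv]
  simp [EuclideanSpace.proj]

lemma coord_C1 {N : ℕ} (j : Fin N) : ContDiff ℝ 1 (fun y : Euc N => y j) :=
  (EuclideanSpace.proj j : Euc N →L[ℝ] ℝ).contDiff

lemma time_deriv {N : ℕ} {Ω : Set (Euc N)} (hO : IsOpen Ω) (hb : Bornology.IsBounded Ω)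
    {φ : ℝ → Euc N → ℝ} (hφ : ContDiff ℝ 1 (fun p : ℝ × Euc N => φ p.1 p.2)) (t : ℝ) :
    HasDerivAt (fun t => ∫ x in Ω, φ t x) (∫ x in Ω, deriv (fun s => φ s x) t) t := by
  have hd : ∀ s x, HasDerivAt (fun s => φ s x)
      (fderiv ℝ (fun p : ℝ × Euc N => φ p.1 p.2) (s, x) (1, 0)) s := by
    intro s x
    have h1 := ((hφ.differentiable one_ne_zero) (s, x)).hasFDerivAt
    have h2 : HasDerivAt (fun s : ℝ => (s, x)) ((1 : ℝ), (0 : Euc N)) s :=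
      (hasDerivAt_id s).prodMk (hasDerivAt_const s x)
    exact h1.comp_hasDerivAt s h2
  set D : ℝ → Euc N → ℝ := fun s x => fderiv ℝ (fun p : ℝ × Euc N => φ p.1 p.2) (s, x) (1, 0)
    with hD
  have hDc : Continuous (fun p : ℝ × Euc N => D p.1 p.2) :=
    (hφ.continuous_fderiv one_ne_zero).clm_apply continuous_const
  have hcpt : IsCompact (closure Ω) := hb.isCompact_closure
  obtain ⟨C, hC⟩ := ((isCompact_Icc (a := t - 1) (b := t + 1)).prod hcpt).exists_bound_of_continuousOn
    hDc.continuousOn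
  have hI : ∀ f : Euc N → ℝ, Continuous f → IntegrableOn f Ω := fun f hf =>
    (hf.continuousOn.integrableOn_compact hcpt).mono_set subset_closure
  have hcs : ∀ s, Continuous (φ s) := fun s =>
    hφ.continuous.comp (continuous_const.prodMk continuous_id)
  have := hasDerivAt_integral_of_dominated_loc_of_deriv_le (μ := volume.restrict Ω)
    (F := φ) (F' := D) (x₀ := t) (s := Set.Icc (t-1) (t+1)) (bound := fun _ => C)
    (Icc_mem_nhds (by linarith) (by linarith))
    (Eventually.of_forall fun s => (hcs s).aestronglyMeasurable)
    (hI _ (hcs t))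
    (hDc.comp (continuous_const.prodMk continuous_id)).aestronglyMeasurable
    ?_ (hI _ continuous_const) (Eventually.of_forall fun x s _ => hd s x)
  · have h3 : (fun x => deriv (fun s => φ s x) t) = D t := by
      ext x; exact (hd t x).deriv
    rw [h3]
    exact this.2
  · filter_upwards [ae_restrict_mem hO.measurableSet] with x hx s hs
    exact hC (s, x) ⟨hs, subset_closure hx⟩

lemma prodInt {N : ℕ} (hN : 4 ≤ N) {f h : Euc N → ℝ} (hf : Continuous f) (hfc : HasCompactSupport f)
    (hh : Continuous h) (hhc : HasCompactSupport h) :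
    Integrable (fun p : Euc N × Euc N => ‖p.1 - p.2‖ ^ ((2 : ℝ) - (N : ℝ)) * (f p.1 * h p.2))
      (volume.prod volume) := by
  obtain ⟨R₁, h1⟩ := hfc.isCompact.isBounded.subset_closedBall (0 : Euc N)
  obtain ⟨R₂, h2⟩ := hhc.isCompact.isBounded.subset_closedBall (0 : Euc N)
  obtain ⟨C, hC⟩ := hfc.exists_bound_of_continuous hf
  have hk : Integrable ((Metric.closedBall (0 : Euc N) (R₁ + R₂)).indicator
      (fun z : Euc N => ‖z‖ ^ ((2 : ℝ) - (N : ℝ)))) volume :=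
    ((locInt_green hN).integrableOn_isCompact (isCompact_closedBall _ _)).integrable_indicator
      measurableSet_closedBall
  have h3 := (hh.integrable_of_hasCompactSupport hhc (μ := volume)).convolution_integrand
    (ContinuousLinearMap.mul ℝ ℝ) hk
  have h4 := h3.bdd_mul (f := fun p : Euc N × Euc N => f p.1) (c := C)
    (hf.comp continuous_fst).aestronglyMeasurable (Eventually.of_forall fun p => hC p.1)
  refine h4.congr (Eventually.of_forall fun p => ?_)
  simp only [ContinuousLinearMap.mul_apply']
  by_cases ha : f p.1 = 0
  · simp [ha]
  by_cases hb : h p.2 = 0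
  · simp [hb]
  have ha' := h1 (subset_tsupport f ha)
  have hb' := h2 (subset_tsupport h hb)
  rw [mem_closedBall_zero_iff] at ha' hb'
  rw [Set.indicator_of_mem]
  · ring
  · rw [mem_closedBall_zero_iff]
    exact (norm_sub_le _ _).trans (add_le_add ha' hb')

def kk (N : ℕ) (ε : ℝ) (z : Euc N) : ℝ := (‖z‖ ^ 2 + ε) ^ (((2 : ℝ) - (N : ℝ)) / 2)
def qq (N : ℕ) (ε : ℝ) (z : Euc N) : ℝ := (‖z‖ ^ 2 + ε) ^ (-(N : ℝ) / 2)

lemma base_pos {N : ℕ} {ε : ℝ} (hε : 0 < ε) (z : Euc N) : 0 < ‖z‖ ^ 2 + ε := by positivity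

lemma kk_C1 {N : ℕ} {ε : ℝ} (hε : 0 < ε) : ContDiff ℝ 1 (kk N ε) :=
  ((contDiff_norm_sq ℝ).add contDiff_const).rpow_const_of_ne (fun z => (base_pos hε z).ne')

lemma qq_cont {N : ℕ} {ε : ℝ} (hε : 0 < ε) : Continuous (qq N ε) :=
  ((continuous_norm.pow 2).add continuous_const).rpow_const
    (fun z => Or.inl (base_pos hε z).ne')

lemma kk_sub_C1 {N : ℕ} {ε : ℝ} (hε : 0 < ε) (x : Euc N) : ContDiff ℝ 1 (fun y => kk N ε (x - y)) :=
  (kk_C1 hε).comp (contDiff_const.sub contDiff_id)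

lemma kk_epartial {N : ℕ} {ε : ℝ} (hε : 0 < ε) (x y : Euc N) (j : Fin N) :
    epartial j (fun y => kk N ε (x - y)) y = -(((2 : ℝ) - N) * ((x - y) j * qq N ε (x - y))) := by
  have h0 : HasFDerivAt (fun y : Euc N => x - y) (-(ContinuousLinearMap.id ℝ (Euc N))) y := by
    simpa using (hasFDerivAt_id y).const_sub x
  have h1 := ((h0.norm_sq).add_const ε).rpow_const (p := ((2 : ℝ) - (N : ℝ)) / 2)
    (Or.inl (base_pos hε (x - y)).ne')
  rw [epartial]
  unfold kk
  rw [h1.fderiv]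
  simp only [qq]
  have : ((2 : ℝ) - (N : ℝ)) / 2 - 1 = -(N : ℝ) / 2 := by ring
  rw [this]
  simp [EuclideanSpace.inner_single_right]
  ring

lemma virial_eps {N : ℕ} {ε : ℝ} (hε : 0 < ε) {r : Euc N → ℝ} (hr : ContDiff ℝ 1 r)
    (hc : HasCompactSupport r) :
    ∑ j, ∫ p : Euc N × Euc N, kk N ε (p.1 - p.2) * ((r p.1 * p.1 j) * epartial j r p.2)
        ∂(volume.prod volume)
      = ((2 : ℝ) - N) / 2 * ∫ p : Euc N × Euc N,
        (‖p.1 - p.2‖ ^ 2 * qq N ε (p.1 - p.2)) * (r p.1 * r p.2) ∂(volume.prod volume) := by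
  have cpt : ∀ {f h : Euc N → ℝ}, Continuous f → Continuous h → HasCompactSupport f →
      HasCompactSupport h → ∀ {k : Euc N × Euc N → ℝ}, Continuous k →
      Integrable (fun p : Euc N × Euc N => k p * (f p.1 * h p.2)) (volume.prod volume) := by
    intro f h hf hh hfc hhc k hk
    refine Continuous.integrable_of_hasCompactSupport (by fun_prop) ?_
    refine HasCompactSupport.intro (hfc.isCompact.prod hhc.isCompact) ?_
    rintro ⟨x, y⟩ hxy
    rw [Set.mem_prod, not_and_or] at hxy
    rcases hxy with hx | hy
    · simp [image_eq_zero_of_notMem_tsupport hx]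
    · simp [image_eq_zero_of_notMem_tsupport hy]
  have hqc := qq_cont (N := N) hε
  have hkc := (kk_C1 (N := N) hε).continuous
  have hrc := hr.continuous
  have hxc : ∀ j : Fin N, Continuous fun x : Euc N => x j := fun j => (coord_C1 j).continuous
  have key : ∀ j, ∫ p : Euc N × Euc N, kk N ε (p.1 - p.2) * ((r p.1 * p.1 j) * epartial j r p.2)
        ∂(volume.prod volume) = ((2 : ℝ) - N) / 2 * ∫ p : Euc N × Euc N,
        ((p.1 j - p.2 j) ^ 2 * qq N ε (p.1 - p.2)) * (r p.1 * r p.2) ∂(volume.prod volume) := by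
    intro j
    have hrj : HasCompactSupport (fun x => r x * x j) := hc.mul_right
    have I1 := cpt (f := fun x => r x * x j) (hrc.mul (hxc j)) (epartial_cont hr j) hrj
      (epartial_cs hc j) (k := fun p => kk N ε (p.1 - p.2)) (by fun_prop)
    have I2 := cpt hrc hrc hc hc (k := fun p => ((2 : ℝ) - N) * ((p.1 j - p.2 j) * p.1 j * qq N ε (p.1 - p.2)))
      (by have := hxc j; fun_prop)
    have I3 := cpt hrc hrc hc hc (k := fun p => ((2 : ℝ) - N) * ((p.2 j - p.1 j) * p.2 j * qq N ε (p.2 - p.1)))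
      (by have := hxc j; fun_prop)
    have e1 : ∫ p : Euc N × Euc N, kk N ε (p.1 - p.2) * ((r p.1 * p.1 j) * epartial j r p.2)
        ∂(volume.prod volume) = ∫ p : Euc N × Euc N,
        (((2 : ℝ) - N) * ((p.1 j - p.2 j) * p.1 j * qq N ε (p.1 - p.2))) * (r p.1 * r p.2)
        ∂(volume.prod volume) := by
      rw [integral_prod _ I1, integral_prod _ I2]
      congr 1
      ext x
      have h := ibp hr (kk_sub_C1 hε x) hc j
      simp only [kk_epartial hε] at h
      have a1 : (fun y => kk N ε (x - y) * (r x * x j * epartial j r y)) =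
        fun y => (r x * x j) * (kk N ε (x - y) * epartial j r y) := by ext y; ring
      have a2 : (fun y => ((2 : ℝ) - N) * ((x j - y j) * x j * qq N ε (x - y)) * (r x * r y)) =
        fun y => (r x * x j) * - (-(((2 : ℝ) - N) * ((x - y) j * qq N ε (x - y))) * r y) := by
          ext y; simp only [PiLp.sub_apply]; ring
      simp only [a1, a2]
      rw [integral_const_mul, h, integral_const_mul, integral_neg]
    have e2 := integral_prod_swap (μ := (volume : Measure (Euc N))) (ν := (volume : Measure (Euc N)))
      (fun p : Euc N × Euc N =>
        (((2 : ℝ) - N) * ((p.1 j - p.2 j) * p.1 j * qq N ε (p.1 - p.2))) * (r p.1 * r p.2))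
    simp only [Prod.fst_swap, Prod.snd_swap] at e2
    have e3 : ∫ p : Euc N × Euc N,
        (((2 : ℝ) - N) * ((p.1 j - p.2 j) * p.1 j * qq N ε (p.1 - p.2))) * (r p.1 * r p.2)
        ∂(volume.prod volume) + ∫ p : Euc N × Euc N,
        (((2 : ℝ) - N) * ((p.2 j - p.1 j) * p.2 j * qq N ε (p.2 - p.1))) * (r p.1 * r p.2)
        ∂(volume.prod volume) = ((2 : ℝ) - N) * ∫ p : Euc N × Euc N,
        ((p.1 j - p.2 j) ^ 2 * qq N ε (p.1 - p.2)) * (r p.1 * r p.2) ∂(volume.prod volume) := by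
      rw [← integral_add I2 I3, ← integral_const_mul]
      congr 1
      ext p
      have : qq N ε (p.2 - p.1) = qq N ε (p.1 - p.2) := by
        simp only [qq, norm_sub_rev p.2 p.1]
      rw [this]; ring
    have e4 : ∫ p : Euc N × Euc N,
        (((2 : ℝ) - N) * ((p.2 j - p.1 j) * p.2 j * qq N ε (p.2 - p.1))) * (r p.1 * r p.2)
        ∂(volume.prod volume) = ∫ p : Euc N × Euc N,
        (((2 : ℝ) - N) * ((p.1 j - p.2 j) * p.1 j * qq N ε (p.1 - p.2))) * (r p.1 * r p.2)
        ∂(volume.prod volume) := by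
      rw [← e2]
      congr 1
      ext p
      ring
    rw [e1]
    linarith
  simp only [key]
  rw [← Finset.mul_sum, ← integral_finsetSum]
  · congr 2
    ext p
    rw [← Finset.sum_mul, ← Finset.sum_mul, EuclideanSpace.norm_sq_eq]
    simp
  · intro j _
    exact cpt hrc hrc hc hc (k := fun p => (p.1 j - p.2 j) ^ 2 * qq N ε (p.1 - p.2))
      (by have := hxc j; fun_prop)

lemma ae_ne (N : ℕ) (hN : 4 ≤ N) :
    ∀ᵐ p : Euc N × Euc N ∂(volume.prod volume), p.1 ≠ p.2 := by
  have : Nonempty (Fin N) := ⟨⟨0, by omega⟩⟩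
  have : Nontrivial (Euc N) := inferInstance
  have h0 : (volume.prod volume : Measure (Euc N × Euc N)) (Set.diagonal (Euc N)) = 0 := by
    rw [Measure.measure_prod_null measurableSet_diagonal]
    refine Eventually.of_forall fun x => ?_
    have : Prod.mk x ⁻¹' Set.diagonal (Euc N) = {x} := by
      ext y; simp [eq_comm]
    simp [this]
  rw [ae_iff]
  convert h0 using 2
  ext p
  simp [Set.mem_diagonal_iff]

lemma kk_le {N : ℕ} (hN : 4 ≤ N) {ε : ℝ} (hε : 0 < ε) {z : Euc N} (hz : z ≠ 0) :
    kk N ε z ≤ ‖z‖ ^ ((2 : ℝ) - (N : ℝ)) := by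
  have hz' : 0 < ‖z‖ := norm_pos_iff.mpr hz
  have h4 : (4 : ℝ) ≤ N := by exact_mod_cast hN
  have : ‖z‖ ^ ((2 : ℝ) - (N : ℝ)) = (‖z‖ ^ 2) ^ (((2 : ℝ) - (N : ℝ)) / 2) := by
    rw [← Real.rpow_natCast, ← Real.rpow_mul hz'.le]; congr 1; push_cast; ring
  rw [this, kk]
  exact Real.rpow_le_rpow_of_nonpos (by positivity) (by linarith) (by linarith)

lemma kk_nonneg {N : ℕ} {ε : ℝ} (hε : 0 < ε) (z : Euc N) : 0 ≤ kk N ε z :=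
  Real.rpow_nonneg (base_pos hε z).le _

lemma kk_eq {N : ℕ} {ε : ℝ} (hε : 0 < ε) (z : Euc N) :
    kk N ε z = (‖z‖ ^ 2 + ε) * qq N ε z := by
  rw [kk, qq]
  nth_rw 2 [← Real.rpow_one (‖z‖ ^ 2 + ε)]
  rw [← Real.rpow_add (base_pos hε z)]
  congr 1; ring

lemma kk_lim {N : ℕ} {z : Euc N} (hz : z ≠ 0) :
    Tendsto (fun n : ℕ => kk N (1 / ((n : ℝ) + 1)) z) atTop (𝓝 (‖z‖ ^ ((2 : ℝ) - (N : ℝ)))) := by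
  have hz' : 0 < ‖z‖ := norm_pos_iff.mpr hz
  have : ‖z‖ ^ ((2 : ℝ) - (N : ℝ)) = (‖z‖ ^ 2 + 0) ^ (((2 : ℝ) - (N : ℝ)) / 2) := by
    rw [add_zero, ← Real.rpow_natCast, ← Real.rpow_mul hz'.le]; congr 1; push_cast; ring
  rw [this]
  exact (tendsto_const_nhds.add tendsto_one_div_add_atTop_nhds_zero_nat).rpow_const
    (Or.inl (by positivity))

lemma qq_lim {N : ℕ} {z : Euc N} (hz : z ≠ 0) :
    Tendsto (fun n : ℕ => ‖z‖ ^ 2 * qq N (1 / ((n : ℝ) + 1)) z) atTop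
      (𝓝 (‖z‖ ^ ((2 : ℝ) - (N : ℝ)))) := by
  have hz' : 0 < ‖z‖ := norm_pos_iff.mpr hz
  have : ‖z‖ ^ ((2 : ℝ) - (N : ℝ)) = ‖z‖ ^ 2 * (‖z‖ ^ 2 + 0) ^ (-(N : ℝ) / 2) := by
    rw [add_zero, ← Real.rpow_natCast, ← Real.rpow_mul hz'.le, ← Real.rpow_add hz']
    congr 1; push_cast; ring
  rw [this]
  exact ((tendsto_const_nhds.add tendsto_one_div_add_atTop_nhds_zero_nat).rpow_const
    (Or.inl (by positivity))).const_mul _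

lemma lim_gen {N : ℕ} (hN : 4 ≤ N) {f h : Euc N → ℝ} (hf : Continuous f)
    (hfc : HasCompactSupport f) (hh : Continuous h) (hhc : HasCompactSupport h)
    {k : ℕ → Euc N → ℝ} (hk : ∀ n, Continuous (k n)) (hk0 : ∀ n z, 0 ≤ k n z)
    (hk1 : ∀ n z, z ≠ 0 → k n z ≤ ‖z‖ ^ ((2 : ℝ) - (N : ℝ)))
    (hk2 : ∀ z, z ≠ 0 → Tendsto (fun n => k n z) atTop (𝓝 (‖z‖ ^ ((2 : ℝ) - (N : ℝ))))) :
    Tendsto (fun n => ∫ p : Euc N × Euc N, k n (p.1 - p.2) * (f p.1 * h p.2)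
      ∂(volume.prod volume)) atTop
      (𝓝 (∫ p : Euc N × Euc N, ‖p.1 - p.2‖ ^ ((2 : ℝ) - (N : ℝ)) * (f p.1 * h p.2)
        ∂(volume.prod volume))) := by
  refine tendsto_integral_of_dominated_convergence
    (fun p : Euc N × Euc N => ‖‖p.1 - p.2‖ ^ ((2 : ℝ) - (N : ℝ)) * (f p.1 * h p.2)‖) ?_
    (prodInt hN hf hfc hh hhc).norm ?_ ?_
  · intro n
    have := hk n
    exact Continuous.aestronglyMeasurable (by fun_prop)
  · intro n
    filter_upwards [ae_ne N hN] with p hp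
    rw [norm_mul, norm_mul (‖p.1 - p.2‖ ^ ((2 : ℝ) - (N : ℝ)))]
    refine mul_le_mul_of_nonneg_right ?_ (norm_nonneg (f p.1 * h p.2))
    rw [Real.norm_of_nonneg (hk0 _ _), Real.norm_of_nonneg (Real.rpow_nonneg (norm_nonneg (p.1 - p.2)) _)]
    exact hk1 n _ (sub_ne_zero.mpr hp)
  · filter_upwards [ae_ne N hN] with p hp
    exact (hk2 _ (sub_ne_zero.mpr hp)).mul_const _

lemma virial {N : ℕ} (hN : 4 ≤ N) {r : Euc N → ℝ} (hr : ContDiff ℝ 1 r)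
    (hc : HasCompactSupport r) :
    ∑ j, ∫ x : Euc N, (r x * x j) * ∫ y, ‖x - y‖ ^ ((2 : ℝ) - (N : ℝ)) * epartial j r y
      = ((2 : ℝ) - N) / 2 * ∫ x : Euc N, r x * ∫ y, ‖x - y‖ ^ ((2 : ℝ) - (N : ℝ)) * r y := by
  have hrc := hr.continuous
  have hxc : ∀ j : Fin N, Continuous fun x : Euc N => x j := fun j => (coord_C1 j).continuous
  have conv : ∀ {f h : Euc N → ℝ}, Continuous f → HasCompactSupport f → Continuous h →
      HasCompactSupport h →
      ∫ x : Euc N, f x * ∫ y, ‖x - y‖ ^ ((2 : ℝ) - (N : ℝ)) * h y =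
      ∫ p : Euc N × Euc N, ‖p.1 - p.2‖ ^ ((2 : ℝ) - (N : ℝ)) * (f p.1 * h p.2)
        ∂(volume.prod volume) := by
    intro f h hf hfc hh hhc
    rw [integral_prod _ (prodInt hN hf hfc hh hhc)]
    congr 1
    ext x
    rw [← integral_const_mul]
    congr 1
    ext y
    ring
  have hrj : ∀ j : Fin N, HasCompactSupport (fun x => r x * x j) := fun j => hc.mul_right
  rw [conv hrc hc hrc hc]
  rw [Finset.sum_congr rfl fun j _ => conv (f := fun x => r x * x j) (hrc.mul (hxc j)) (hrj j) (epartial_cont hr j)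
    (epartial_cs hc j)]
  have hpos : ∀ n : ℕ, 0 < 1 / ((n : ℝ) + 1) := fun n => by positivity
  have L1 := tendsto_finsetSum (Finset.univ : Finset (Fin N)) fun j _ =>
    lim_gen hN (f := fun x => r x * x j) (hrc.mul (hxc j)) (hrj j) (epartial_cont hr j)
    (epartial_cs hc j) (k := fun n => kk N (1 / ((n : ℝ) + 1)))
    (fun n => (kk_C1 (hpos n)).continuous) (fun n => kk_nonneg (hpos n))
    (fun n z hz => kk_le hN (hpos n) hz) (fun z hz => kk_lim hz)
  have L2 := (lim_gen hN hrc hc hrc hc (k := fun n z => ‖z‖ ^ 2 * qq N (1 / ((n : ℝ) + 1)) z)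
    (fun n => by have := qq_cont (N := N) (hpos n); fun_prop)
    (fun n z => by have := (base_pos (hpos n) z).le; unfold qq; positivity)
    (fun n z hz => by
      refine le_trans ?_ (kk_le hN (hpos n) hz)
      rw [kk_eq (hpos n)]
      have : 0 ≤ qq N (1 / ((n : ℝ) + 1)) z := Real.rpow_nonneg (base_pos (hpos n) z).le _
      have h2 := hpos n
      nlinarith [mul_nonneg h2.le this])
    (fun z hz => qq_lim hz)).const_mul (((2 : ℝ) - N) / 2)
  refine tendsto_nhds_unique L1 ?_
  refine L2.congr fun n => ?_
  exact (virial_eps (hpos n) hr hc).symm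

lemma mass_int {N : ℕ} {r : Euc N → ℝ} {v : Euc N → Euc N} (hr : ContDiff ℝ 1 r)
    (hv : ContDiff ℝ 1 v) (hc : HasCompactSupport r) :
    ∫ x, -(ediv (fun y => r y • v y) x) * ‖x‖ ^ 2 = 2 * ∫ x, ∑ j, x j * (r x * v x j) := by
  have hvj : ∀ j, ContDiff ℝ 1 (fun y => v y j) := fun j => (coord_C1 j).comp hv
  have hf : ∀ j, ContDiff ℝ 1 (fun y => r y * v y j) := fun j => hr.mul (hvj j)
  have hfc : ∀ j, HasCompactSupport (fun y => r y * v y j) := fun j => hc.mul_right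
  have hn : ContDiff ℝ 1 (fun x : Euc N => ‖x‖ ^ 2) := contDiff_norm_sq ℝ
  have hnp : ∀ j (x : Euc N), epartial j (fun x : Euc N => ‖x‖ ^ 2) x = 2 * x j := by
    intro j x
    have h := (hasFDerivAt_id x).norm_sq
    simp only [id] at h
    rw [epartial, h.fderiv]
    simp [EuclideanSpace.inner_single_right]
  have e1 : ∀ x, -(ediv (fun y => r y • v y) x) * ‖x‖ ^ 2 =
      ∑ j, -(‖x‖ ^ 2 * epartial j (fun y => r y * v y j) x) := by
    intro x
    simp only [ediv, epartial, PiLp.smul_apply, smul_eq_mul]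
    rw [Finset.sum_neg_distrib, ← Finset.mul_sum]
    ring
  simp only [e1]
  rw [integral_finsetSum, integral_finsetSum, Finset.mul_sum]
  · refine Finset.sum_congr rfl fun j _ => ?_
    rw [integral_neg, ibp (hf j) hn (hfc j), neg_neg, ← integral_const_mul]
    congr 1
    ext x
    rw [hnp]; ring
  · intro j _
    exact Continuous.integrable_of_hasCompactSupport ((coord_C1 j).continuous.mul (hf j).continuous)
      (hfc j).mul_left
  · intro j _
    exact (Continuous.integrable_of_hasCompactSupport
      (hn.continuous.mul (epartial_cont (hf j) j)) (epartial_cs (hfc j) j).mul_left).neg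

lemma mom_int {N : ℕ} {K γ : ℝ} (hγ : 1 < γ) {r : Euc N → ℝ} {v : Euc N → Euc N}
    {Φ : Euc N → ℝ} (hr : ContDiff ℝ 1 r)
    (hv : ContDiff ℝ 1 v) (hΦ : ContDiff ℝ 1 Φ) (hc : HasCompactSupport r) :
    ∫ x : Euc N, ∑ j, x j * (-(∑ i, epartial i (fun y => r y * v y i * v y j) x)
      - epartial j (fun y => K * r y ^ γ) x - r x * epartial j Φ x)
    = (∫ x, r x * ‖v x‖ ^ 2) + N * (∫ x, K * r x ^ γ) - ∑ j, ∫ x, (r x * x j) * epartial j Φ x := by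
  have hvj : ∀ j, ContDiff ℝ 1 (fun y => v y j) := fun j => (coord_C1 j).comp hv
  have hf : ∀ i j, ContDiff ℝ 1 (fun y => r y * v y i * v y j) :=
    fun i j => (hr.mul (hvj i)).mul (hvj j)
  have hfc : ∀ i j, HasCompactSupport (fun y => r y * v y i * v y j) :=
    fun i j => (hc.mul_right (f' := fun y => v y i)).mul_right
  have hP : ContDiff ℝ 1 (fun y => K * r y ^ γ) :=
    contDiff_const.mul (hr.rpow_const_of_le (by exact_mod_cast hγ.le))
  have hPc : HasCompactSupport (fun y => K * r y ^ γ) :=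
    hc.comp_left (g := fun s => K * s ^ γ) (by rw [Real.zero_rpow (by linarith), mul_zero])
  have hx := fun j : Fin N => (coord_C1 (N := N) j).continuous
  have Ia : ∀ i j, Integrable (fun x : Euc N => x j * epartial i (fun y => r y * v y i * v y j) x) :=
    fun i j => Continuous.integrable_of_hasCompactSupport
      ((hx j).mul (epartial_cont (hf i j) i)) (epartial_cs (hfc i j) i).mul_left
  have Ib : ∀ j, Integrable (fun x : Euc N => x j * epartial j (fun y => K * r y ^ γ) x) :=
    fun j => Continuous.integrable_of_hasCompactSupport
      ((hx j).mul (epartial_cont hP j)) (epartial_cs hPc j).mul_left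
  have Ic : ∀ j, Integrable (fun x : Euc N => (r x * x j) * epartial j Φ x) :=
    fun j => Continuous.integrable_of_hasCompactSupport
      ((hr.continuous.mul (hx j)).mul (epartial_cont hΦ j))
      ((hc.mul_right (f' := fun y : Euc N => y j)).mul_right)
  have Id : ∀ j, Integrable (fun x : Euc N => r x * v x j * v x j) :=
    fun j => Continuous.integrable_of_hasCompactSupport (hf j j).continuous (hfc j j)
  have ea : ∀ i j, ∫ x : Euc N, x j * epartial i (fun y => r y * v y i * v y j) x
      = - (if j = i then ∫ x : Euc N, r x * v x j * v x j else 0) := by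
    intro i j
    rw [ibp (hf i j) (coord_C1 j) (hfc i j)]
    simp only [epartial_coord]
    split_ifs with h
    · subst h; simp
    · simp
  have eb : ∀ j, ∫ x : Euc N, x j * epartial j (fun y => K * r y ^ γ) x
      = - ∫ x : Euc N, K * r x ^ γ := by
    intro j
    rw [ibp hP (coord_C1 j) hPc]
    simp only [epartial_coord]
    simp
  have e0 : ∀ (x : Euc N) j, x j * (-(∑ i, epartial i (fun y => r y * v y i * v y j) x)
      - epartial j (fun y => K * r y ^ γ) x - r x * epartial j Φ x) =
      -(∑ i, x j * epartial i (fun y => r y * v y i * v y j) x)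
      - x j * epartial j (fun y => K * r y ^ γ) x - (r x * x j) * epartial j Φ x := by
    intro x j
    rw [← Finset.mul_sum]; ring
  simp only [e0]
  have Ia' : ∀ j, Integrable (fun x : Euc N => ∑ i, x j * epartial i (fun y => r y * v y i * v y j) x) :=
    fun j => integrable_finsetSum _ fun i _ => Ia i j
  have Iall : ∀ j, Integrable (fun x : Euc N =>
      -(∑ i, x j * epartial i (fun y => r y * v y i * v y j) x)
      - x j * epartial j (fun y => K * r y ^ γ) x - (r x * x j) * epartial j Φ x) :=
    fun j => (((Ia' j).neg.sub (Ib j)).sub (Ic j))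
  have Iab : ∀ j, Integrable (fun x : Euc N =>
      -(∑ i, x j * epartial i (fun y => r y * v y i * v y j) x)
      - x j * epartial j (fun y => K * r y ^ γ) x) :=
    fun j => ((Ia' j).neg.sub (Ib j))
  have Ian : ∀ j, Integrable (fun x : Euc N =>
      -(∑ i, x j * epartial i (fun y => r y * v y i * v y j) x)) :=
    fun j => (Ia' j).neg
  rw [integral_finsetSum _ fun j _ => Iall j]
  have e2 : ∀ j, ∫ x : Euc N, (-(∑ i, x j * epartial i (fun y => r y * v y i * v y j) x)
      - x j * epartial j (fun y => K * r y ^ γ) x - (r x * x j) * epartial j Φ x) =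
      (∫ x : Euc N, r x * v x j * v x j) + (∫ x : Euc N, K * r x ^ γ)
        - ∫ x : Euc N, (r x * x j) * epartial j Φ x := by
    intro j
    rw [integral_sub (Iab j) (Ic j), integral_sub (Ian j) (Ib j), eb j,
      integral_neg, integral_finsetSum _ fun i _ => Ia i j]
    simp [ea]
  simp only [e2]
  rw [Finset.sum_sub_distrib, Finset.sum_add_distrib, ← integral_finsetSum _ fun j _ => Id j]
  simp only [Finset.sum_const, Finset.card_univ, Fintype.card_fin, nsmul_eq_mul]
  congr 3
  ext x
  rw [EuclideanSpace.norm_sq_eq, Finset.mul_sum]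
  refine Finset.sum_congr rfl fun j _ => ?_
  rw [Real.norm_eq_abs, sq_abs]; ring

lemma press_lower {N : ℕ} {Ω : Set (Euc N)} (hb : Bornology.IsBounded Ω)
    {γ M : ℝ} (hγ : 1 < γ) (hM : 0 < M) :
    ∃ c, 0 < c ∧ ∀ r : Euc N → ℝ, Continuous r → (∀ x, 0 ≤ r x) →
      (∫ x in Ω, r x) = M → c ≤ ∫ x in Ω, r x ^ γ := by
  have hfin : volume Ω ≠ ⊤ := hb.measure_lt_top.ne
  set V := volume.real Ω with hV
  have hV0 : 0 ≤ V := measureReal_nonneg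
  set δ := M / (2 * (V + 1)) with hδ
  have hδ0 : 0 < δ := by positivity
  have hδV : δ * V ≤ M / 2 := by
    rw [hδ, div_mul_eq_mul_div, div_le_iff₀ (by positivity)]
    nlinarith
  refine ⟨δ ^ (γ - 1) * (M / 2), by positivity, fun r hr h0 hm => ?_⟩
  have hI : ∀ f : Euc N → ℝ, Continuous f → IntegrableOn f Ω := fun f hf =>
    (hf.continuousOn.integrableOn_compact hb.isCompact_closure).mono_set subset_closure
  have hrγ : Continuous (fun x => r x ^ γ) := hr.rpow_const (fun x => Or.inr (by linarith))
  have pw : ∀ x, δ ^ (γ - 1) * r x ≤ δ ^ (γ - 1) * δ + r x ^ γ := by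
    intro x
    have hp : 0 < δ ^ (γ - 1) := by positivity
    have hq : 0 ≤ r x ^ γ := Real.rpow_nonneg (h0 x) _
    rcases le_or_gt (r x) δ with h | h
    · nlinarith
    · have hx : 0 < r x := hδ0.trans h
      have h1 : δ ^ (γ - 1) ≤ r x ^ (γ - 1) :=
        Real.rpow_le_rpow hδ0.le h.le (by linarith)
      have h2 : r x ^ γ = r x ^ (γ - 1) * r x := by
        nth_rw 3 [← Real.rpow_one (r x)]
        rw [← Real.rpow_add hx]; congr 1; ring
      rw [h2]
      nlinarith [mul_pos hp hδ0]
  have h := setIntegral_mono (μ := volume) (s := Ω) (f := fun x => δ ^ (γ - 1) * r x)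
    (g := fun x => δ ^ (γ - 1) * δ + r x ^ γ) (hI _ (continuous_const.mul hr)) (hI _ (continuous_const.add hrγ)) pw
  rw [integral_const_mul, hm, integral_add (hI _ continuous_const) (hI _ hrγ)] at h
  simp only [setIntegral_const, smul_eq_mul] at h
  have hp : 0 < δ ^ (γ - 1) := by positivity
  rw [← hV] at h
  nlinarith [mul_le_mul_of_nonneg_left hδV hp.le]

lemma ode_contra {H F F' : ℝ → ℝ} {c : ℝ} (hc : 0 < c) (hH0 : ∀ t, 0 < t → 0 ≤ H t)
    (hH : ∀ t, 0 < t → HasDerivAt H (2 * F t) t) (hF : ∀ t, 0 < t → HasDerivAt F (F' t) t)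
    (hF' : ∀ t, 0 < t → F' t ≤ -c) : False := by
  have mv : ∀ (f f' : ℝ → ℝ) (C a b : ℝ), 0 < a → a ≤ b → (∀ t, a ≤ t → HasDerivAt f (f' t) t) →
      (∀ t, a ≤ t → f' t ≤ C) → f b - f a ≤ C * (b - a) := by
    intro f f' C a b ha hab hd hC
    refine (convex_Icc a b).image_sub_le_mul_sub_of_deriv_le
      (fun t ht => (hd t ht.1).continuousAt.continuousWithinAt) ?_ ?_ a
      ⟨le_rfl, hab⟩ b ⟨hab, le_rfl⟩ hab
    · intro t ht
      rw [interior_Icc] at ht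
      exact (hd t ht.1.le).differentiableAt.differentiableWithinAt
    · intro t ht
      rw [interior_Icc] at ht
      rw [(hd t ht.1.le).deriv]
      exact hC t ht.1.le
  set T := 1 + (|F 1| + 1) / c with hT
  have hT1 : 1 ≤ T := by rw [hT]; have : 0 ≤ (|F 1| + 1) / c := by positivity
                         linarith
  have hFT : ∀ t, T ≤ t → F t ≤ -1 := by
    intro t ht
    have := mv F F' (-c) 1 t one_pos (hT1.trans ht) (fun s hs => hF s (by linarith))
      (fun s hs => hF' s (by linarith))
    have h2 : c * (T - 1) = |F 1| + 1 := by rw [hT]; field_simp; ring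
    have h3 := le_abs_self (F 1)
    nlinarith [mul_le_mul_of_nonneg_left ht hc.le]
  have hHT := hH0 T (by linarith)
  have h4 := mv H (fun t => 2 * F t) (-2) T (T + H T + 1) (by linarith) (by linarith)
    (fun s hs => hH s (by linarith)) (fun s hs => by have := hFT s hs; linarith)
  have h5 := hH0 (T + H T + 1) (by linarith)
  nlinarith

/-- For `N ≥ 4` and `1 < γ < 2(N-1)/N`, there is no global
classical solution with positive total mass of the Euler–Poisson equations
without damping whose conserved total energy satisfies `E = 0`. -/
theorem blowup_zero_energy (N : ℕ) (hN : 4 ≤ N) (K γ g : ℝ)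
    (hK : 0 < K) (hg : 0 < g) (hγ1 : 1 < γ) (hγ2 : γ < 2 * ((N : ℝ) - 1) / N)
    (Ω : Set (Euc N)) (ρ : ℝ → Euc N → ℝ) (u : ℝ → Euc N → Euc N)
    (hsol : IsEPSolution N K γ 0 g Ω ⊤ ρ u)
    (M : ℝ) (hM : ∀ t : ℝ, 0 ≤ t → (∫ x in Ω, ρ t x) = M) (hMpos : 0 < M)
    (hE : ∀ t : ℝ, 0 ≤ t → energy N K γ g Ω ρ u t = 0) :
    False := by
  have hγ0 : γ ≠ 0 := by linarith
  have hlt : ∀ t : ℝ, (t : EReal) < ⊤ := fun t => EReal.coe_lt_top t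
  have hO := hsol.omega_open
  have hB := hsol.omega_bounded
  have hrC : ∀ t, ContDiff ℝ 1 (ρ t) := fun t =>
    hsol.rho_C1.comp (contDiff_const.prodMk contDiff_id)
  have huC : ∀ t, ContDiff ℝ 1 (u t) := fun t =>
    hsol.u_C1.comp (contDiff_const.prodMk contDiff_id)
  have hz : ∀ t, 0 ≤ t → ∀ x, x ∉ Ω → ρ t x = 0 := by
    intro t ht x hx
    by_contra h
    exact hx (hsol.support_subset t ht (hlt t) h)
  have hcs : ∀ t, 0 ≤ t → HasCompactSupport (ρ t) := fun t ht =>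
    HasCompactSupport.intro hB.isCompact_closure fun x hx => hz t ht x fun h => hx (subset_closure h)
  have hdz : ∀ t, 0 < t → ∀ x, x ∉ Ω → ∀ c : ℝ → ℝ, deriv (fun s => ρ s x * c s) t = 0 := by
    intro t ht x hx c
    have : (fun s => ρ s x * c s) =ᶠ[𝓝 t] fun _ => 0 := by
      filter_upwards [Ioi_mem_nhds ht] with s hs
      rw [hz s (le_of_lt hs) x hx, zero_mul]
    rw [this.deriv_eq, deriv_const]
  have hpair : ∀ x : Euc N, ContDiff ℝ 1 (fun s : ℝ => (s, x)) := fun x =>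
    contDiff_id.prodMk contDiff_const
  have hrt : ∀ x, Differentiable ℝ (fun s => ρ s x) := fun x =>
    (hsol.rho_C1.comp (hpair x)).differentiable one_ne_zero
  have hut : ∀ x j, Differentiable ℝ (fun s => u s x j) := fun x j =>
    ((coord_C1 j).comp (hsol.u_C1.comp (hpair x))).differentiable one_ne_zero
  -- the three integrals
  set A : ℝ → ℝ := fun t => ∫ x, ρ t x * ‖u t x‖ ^ 2 with hA
  set P : ℝ → ℝ := fun t => ∫ x, K * ρ t x ^ γ with hP
  set W : ℝ → ℝ := fun t => ∫ x, ρ t x * potential N g ρ t x with hW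
  have hgreen : ∀ z : Euc N, green N z = -(‖z‖ ^ ((2 : ℝ) - (N : ℝ))) := by
    intro z; rw [green, if_neg (by omega)]
  have hloc := locInt_green hN
  have hpot : ∀ t, potential N g ρ t = fun x => (-g) * ∫ y, ‖x - y‖ ^ ((2 : ℝ) - (N : ℝ)) * ρ t y := by
    intro t
    ext x
    simp only [potential, hgreen, neg_mul, integral_neg]
    ring
  have hpotC : ∀ t, 0 ≤ t → ContDiff ℝ 1 (potential N g ρ t) := by
    intro t ht
    rw [hpot]
    exact contDiff_const.mul (conv_props hloc (hrC t) (hcs t ht)).1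
  have hpotD : ∀ t, 0 ≤ t → ∀ j x, epartial j (potential N g ρ t) x =
      (-g) * ∫ y, ‖x - y‖ ^ ((2 : ℝ) - (N : ℝ)) * epartial j (ρ t) y := by
    intro t ht j x
    obtain ⟨h1, h2⟩ := conv_props hloc (hrC t) (hcs t ht)
    rw [← h2 j x, hpot, epartial, epartial, fderiv_const_mul ((h1.differentiable one_ne_zero) x)]
    rfl
  have hvir : ∀ t, 0 ≤ t → ∑ j, ∫ x, (ρ t x * x j) * epartial j (potential N g ρ t) x
      = (2 - (N : ℝ)) / 2 * W t := by
    intro t ht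
    have h := virial hN (hrC t) (hcs t ht)
    simp only [hpotD t ht, hW]
    rw [hpot]
    simp only [mul_left_comm _ (-g), integral_const_mul]
    rw [← Finset.mul_sum, h]
    try ring
  have hen : ∀ t, 0 ≤ t → 1 / 2 * A t + P t / (γ - 1) + 1 / 2 * W t = 0 := by
    intro t ht
    have h := hE t ht
    have hrc := (hrC t).continuous
    have huc := (huC t).continuous
    have hφc := (hpotC t ht).continuous
    have IA : Integrable (fun x => 1 / 2 * ρ t x * ‖u t x‖ ^ 2) := by
      refine Continuous.integrable_of_hasCompactSupport (by fun_prop) ?_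
      exact ((hcs t ht).mul_left (f := fun _ => (1 / 2 : ℝ))).mul_right
    have IW : Integrable (fun x => 1 / 2 * ρ t x * potential N g ρ t x) := by
      refine Continuous.integrable_of_hasCompactSupport (by fun_prop) ?_
      exact ((hcs t ht).mul_left (f := fun _ => (1 / 2 : ℝ))).mul_right
    have IP : Integrable (fun x => K * ρ t x ^ γ / (γ - 1)) := by
      refine Continuous.integrable_of_hasCompactSupport
        ((continuous_const.mul (hrc.rpow_const (fun x => Or.inr (by linarith)))).div_const _) ?_
      exact (hcs t ht).comp_left (g := fun s => K * s ^ γ / (γ - 1))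
        (by rw [Real.zero_rpow hγ0]; simp)
    rw [energy, setIntegral_eq_integral_of_forall_compl_eq_zero, integral_add (by exact IA.add IP) IW,
      integral_add IA IP] at h
    · simp only [mul_assoc, integral_const_mul, div_eq_mul_inv] at h
      simp only [hA, hP, hW]
      rw [← h]
      simp only [div_eq_mul_inv, one_mul, integral_mul_const, integral_const_mul, mul_assoc]
    · intro x hx
      rw [hz t ht x hx, Real.zero_rpow hγ0]; simp
  obtain ⟨c, hc0, hc⟩ := press_lower hB hγ1 hMpos
  have hPlow : ∀ t, 0 ≤ t → K * c ≤ P t := by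
    intro t ht
    have := hc (ρ t) (hrC t).continuous (hsol.rho_nonneg t) (hM t ht)
    rw [setIntegral_eq_integral_of_forall_compl_eq_zero
      (fun x hx => by rw [hz t ht x hx, Real.zero_rpow hγ0])] at this
    simp only [hP]
    rw [integral_const_mul]
    exact mul_le_mul_of_nonneg_left this hK.le
  have hApos : ∀ t, 0 ≤ A t := fun t => integral_nonneg fun x =>
    mul_nonneg (hsol.rho_nonneg t x) (by positivity)
  set F : ℝ → ℝ := fun t => ∫ x in Ω, ∑ j, x j * (ρ t x * u t x j) with hF
  have hFd : ∀ t, 0 < t → HasDerivAt F (A t + N * P t - (2 - (N : ℝ)) / 2 * W t) t := by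
    intro t ht
    have hd := time_deriv hO hB (φ := fun t x => ∑ j, x j * (ρ t x * u t x j)) (by
      refine ContDiff.sum fun j _ => ?_
      exact ((coord_C1 j).comp contDiff_snd).mul
        (hsol.rho_C1.mul ((coord_C1 j).comp hsol.u_C1))) t
    convert hd using 1
    have e : ∀ x : Euc N, deriv (fun s => ∑ j, x j * (ρ s x * u s x j)) t =
        ∑ j, x j * deriv (fun s => ρ s x * u s x j) t := by
      intro x
      have hpd : ∀ j, DifferentiableAt ℝ (fun s => ρ s x * u s x j) t :=
        fun j => ((hrt x).mul (hut x j)) t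
      rw [deriv_fun_sum fun j _ => (hpd j).const_mul _]
      refine Finset.sum_congr rfl fun j _ => ?_
      exact deriv_const_mul _ (hpd j)
    simp only [e]
    rw [setIntegral_eq_integral_of_forall_compl_eq_zero (fun x hx => by
      refine Finset.sum_eq_zero fun j _ => ?_
      rw [hdz t ht x hx, mul_zero])]
    rw [← hvir t ht.le]
    have hm := mom_int (K := K) hγ1 (hrC t) (huC t) (hpotC t ht.le) (hcs t ht.le)
    rw [← hm]
    congr 1
    ext x
    refine Finset.sum_congr rfl fun j _ => ?_
    have := hsol.momentum_eq t ht.le (hlt t) x j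
    congr 1
    linarith
  have hHd : ∀ t, 0 < t → HasDerivAt (inertia N Ω ρ) (2 * F t) t := by
    intro t ht
    have hd := time_deriv hO hB (φ := fun t x => ρ t x * ‖x‖ ^ 2)
      (hsol.rho_C1.mul ((contDiff_norm_sq ℝ).comp contDiff_snd)) t
    change HasDerivAt (inertia N Ω ρ) _ t at hd
    convert hd using 1
    rw [setIntegral_eq_integral_of_forall_compl_eq_zero (fun x hx =>
      hdz t ht x hx fun _ => ‖x‖ ^ 2)]
    simp only [hF]
    rw [setIntegral_eq_integral_of_forall_compl_eq_zero (fun x hx => by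
      refine Finset.sum_eq_zero fun j _ => ?_
      rw [hz t ht.le x hx, zero_mul, mul_zero])]
    rw [← mass_int (hrC t) (huC t) (hcs t ht.le)]
    congr 1
    ext x
    rw [deriv_mul_const ((hrt x) t)]
    have := hsol.continuity_eq t ht.le (hlt t) x
    congr 1
    linarith
  have h4 : (4 : ℝ) ≤ N := by exact_mod_cast hN
  have hcoef : 0 < ((N : ℝ) - 2) / (γ - 1) - N := by
    rw [sub_pos, lt_div_iff₀ (by linarith)]
    rw [lt_div_iff₀ (by linarith)] at hγ2
    linarith
  refine ode_contra (H := inertia N Ω ρ) (c := (((N : ℝ) - 2) / (γ - 1) - N) * (K * c))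
    (by positivity) ?_ hHd hFd ?_
  · intro t _
    exact integral_nonneg fun x => mul_nonneg (hsol.rho_nonneg t x) (by positivity)
  · intro t ht
    have h1 := hen t ht.le
    have h2 := mul_le_mul_of_nonneg_left (hPlow t ht.le) hcoef.le
    have h3 := hApos t
    have hWt : W t = - A t - 2 * (P t / (γ - 1)) := by linarith
    have e : A t + N * P t - (2 - (N : ℝ)) / 2 * W t =
        (4 - (N : ℝ)) / 2 * A t - (((N : ℝ) - 2) / (γ - 1) - N) * P t := by
      rw [hWt]; ring
    rw [e]
    nlinarith
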